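/- arXiv:2405.07398 — 2 statements merged into one kernel-verified Lean document; each statement's English description precedes it below -/
import Mathlib

section
/- Let ω = e^{iθ} with θ ∈ (0,2π)\{π}, and let N₃(θ,b) ∈ Sp(6) be the triple-collision normal form. Then ω and ω̄ are eigenvalues of N₃(θ,b) of algebraic multiplicity 3, and dim_ℂ ker_ℂ(N₃(θ,b) − ωI) = 1. Moreover, with M_α = N₃(θ,b)·diag(R(α),R(α),R(α)) and D_ω(M) := ω⁻³ det(M − ωI), one has D_ω(M_α)|_{α=0} = 0 and (∂/∂α) D_ω(M_α)|_{α=0} = 8 sin³θ; hence there exists α₀ > 0 with D_ω(M_α) ≠ 0 for 0 < |α| < α₀. -/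
open Matrix Set Polynomial

noncomputable section

/-- The triple-collision normal form `N₃(θ, b) ∈ Sp(6)`. -/
def N3 (θ b₁ b₂ b₃ b₄ : ℝ) : Matrix (Fin 6) (Fin 6) ℝ :=
  !![Real.cos θ, b₁, -Real.sin θ, b₂, 1, 0;
     0, Real.cos θ, 0, -Real.sin θ, 0, 0;
     Real.sin θ, b₃, Real.cos θ, b₄, 0, 1;
     0, Real.sin θ, 0, Real.cos θ, 0, 0;
     0, Real.sin (2*θ), 0, Real.cos (2*θ), Real.cos θ, -Real.sin θ;
     0, -Real.cos (2*θ), 0, Real.sin (2*θ), Real.sin θ, Real.cos θ]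

/-- The block rotation `diag(R(α), R(α), R(α)) ∈ Sp(6)`. -/
def Rd6 (α : ℝ) : Matrix (Fin 6) (Fin 6) ℝ :=
  !![Real.cos α, -Real.sin α, 0, 0, 0, 0;
     Real.sin α, Real.cos α, 0, 0, 0, 0;
     0, 0, Real.cos α, -Real.sin α, 0, 0;
     0, 0, Real.sin α, Real.cos α, 0, 0;
     0, 0, 0, 0, Real.cos α, -Real.sin α;
     0, 0, 0, 0, Real.sin α, Real.cos α]

/-- `D_ω(M) = ω⁻³ det(M − ωI)` evaluated on `M_α = N₃(θ,b)·diag(R(α),R(α),R(α))`. -/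
def Dfun (θ b₁ b₂ b₃ b₄ : ℝ) (α : ℝ) : ℂ :=
  (Complex.exp (θ * Complex.I))⁻¹ ^ 3 *
    (((N3 θ b₁ b₂ b₃ b₄ * Rd6 α).map (fun x : ℝ => (x : ℂ))
      - Complex.exp (θ * Complex.I) • (1 : Matrix (Fin 6) (Fin 6) ℂ)).det)

/-- The part of the determinant that is divisible by `q ^ 2`. -/
def remE {R : Type*} [CommRing R] (p q s b1 b2 b3 b4 u v : R) : R :=
  (1)*v^2 + (1)*u^2 + (1)*s^1*b4^1*v^1 + (1)*s^1*b3^1*u^1 + (-1)*s^1*b2^1*u^1 +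
    (1)*s^1*b1^1*v^1 + (2)*s^2*v^1 + (-1)*s^2*b2^1*b3^1 + (1)*s^2*b1^1*b4^1 + (2)*s^3*b4^1
    + (2)*s^3*b1^1 + (-1)*s^4 + (1)*q^1*b4^1*v^1 + (1)*q^1*b3^1*u^1 + (-1)*q^1*b2^1*u^1 +
    (1)*q^1*b1^1*v^1 + (-2)*q^1*s^1*v^1 + (-2)*q^1*s^1*b2^1*b3^1 + (2)*q^1*s^1*b1^1*b4^1 +
    (-4)*q^1*s^3 + (-2)*q^2*v^1 + (-1)*q^2*b2^1*b3^1 + (1)*q^2*b1^1*b4^1 +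
    (-2)*q^2*s^1*b4^1 + (-2)*q^2*s^1*b1^1 + (-1)*q^2*s^2 + (-1)*q^3*b4^1 + (-1)*q^3*b1^1 +
    (2)*q^3*s^1 + (1)*q^4 + (-1)*p^1*b4^1*u^1 + (1)*p^1*b3^1*v^1 + (-1)*p^1*b2^1*v^1 +
    (-1)*p^1*b1^1*u^1 + (-4)*p^1*s^1*u^1 + (-4)*p^1*s^2*b3^1 + (4)*p^1*s^2*b2^1 +
    (2)*p^1*q^1*u^1 + (-2)*p^1*q^1*s^1*b3^1 + (2)*p^1*q^1*s^1*b2^1 + (-2)*p^2*v^1 +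
    (-1)*p^2*b2^1*b3^1 + (1)*p^2*b1^1*b4^1 + (-2)*p^2*s^1*b4^1 + (-2)*p^2*s^1*b1^1 +
    (2)*p^2*s^2 + (-2)*p^2*q^1*b4^1 + (-2)*p^2*q^1*b1^1 + (4)*p^2*q^1*s^1 + (3)*p^2*q^2 +
    (3)*p^4

/-- The sparse matrix `N₃ - ω R(-α)` with `p = cos θ - ω cos α`, `q = ω sin α`. -/
def sparseM {R : Type*} [CommRing R] (p q s b1 b2 b3 b4 u v : R) : Matrix (Fin 6) (Fin 6) R :=
  !![p, b1 - q, -s, b2, 1, 0;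
     q, p, 0, -s, 0, 0;
     s, b3, p, b4 - q, 0, 1;
     0, s, q, p, 0, 0;
     0, u, 0, v, p, -s - q;
     0, -v, 0, u, s + q, p]

set_option maxHeartbeats 4000000 in
lemma sparseM_det {R : Type*} [CommRing R] (p q s b1 b2 b3 b4 u v : R) :
    (sparseM p q s b1 b2 b3 b4 u v).det = (p ^ 2 + s ^ 2) ^ 3
      + q * (2 * s ^ 3 * v - 6 * p * s ^ 2 * u - 6 * p ^ 2 * s * v + 2 * p ^ 3 * u
        + (p ^ 2 + s ^ 2) * (2 * p * s * (b2 - b3) + (s ^ 2 - p ^ 2) * (b1 + b4)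
          + 2 * s * (p ^ 2 + s ^ 2)))
      + q ^ 2 * remE p q s b1 b2 b3 b4 u v := by
  simp only [sparseM, remE]
  simp [Matrix.det_succ_row_zero, Fin.sum_univ_succ, Fin.succAbove]
  ring

/-- The inverse of the block rotation. -/
lemma Rd6_mul (α : ℝ) : Rd6 (-α) * Rd6 α = 1 := by
  have h := Real.sin_sq_add_cos_sq α
  ext i j
  fin_cases i <;> fin_cases j <;>
    simp [Rd6, Matrix.mul_apply, Fin.sum_univ_succ] <;> nlinarith

lemma Rd6_det (α : ℝ) : (Rd6 α).det = 1 := by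
  have h := Real.sin_sq_add_cos_sq α
  simp [Rd6, Matrix.det_succ_row_zero, Fin.sum_univ_succ, Fin.succAbove]
  linear_combination ((Real.sin α ^ 2 + Real.cos α ^ 2) ^ 2
    + (Real.sin α ^ 2 + Real.cos α ^ 2) + 1) * h

lemma exp_eq (θ : ℝ) : Complex.exp (θ * Complex.I)
    = (Real.cos θ : ℂ) + (Real.sin θ : ℂ) * Complex.I := by
  rw [Complex.exp_mul_I]; simp

lemma sparse_eq (θ b₁ b₂ b₃ b₄ α : ℝ) (w : ℂ) :
    (N3 θ b₁ b₂ b₃ b₄).map (fun x : ℝ => (x : ℂ)) - w • (Rd6 (-α)).map (fun x : ℝ => (x : ℂ))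
      = sparseM ((Real.cos θ : ℂ) - w * (Real.cos α : ℂ)) (w * (Real.sin α : ℂ)) (Real.sin θ : ℂ)
        b₁ b₂ b₃ b₄ (Real.sin (2 * θ) : ℂ) (Real.cos (2 * θ) : ℂ) := by
  ext i j
  fin_cases i <;> fin_cases j <;> simp [N3, Rd6, sparseM]

lemma det_eq (θ b₁ b₂ b₃ b₄ α : ℝ) (w : ℂ) :
    (((N3 θ b₁ b₂ b₃ b₄ * Rd6 α).map (fun x : ℝ => (x : ℂ))
      - w • (1 : Matrix (Fin 6) (Fin 6) ℂ)).det)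
      = (sparseM ((Real.cos θ : ℂ) - w * (Real.cos α : ℂ)) (w * (Real.sin α : ℂ)) (Real.sin θ : ℂ)
        b₁ b₂ b₃ b₄ (Real.sin (2 * θ) : ℂ) (Real.cos (2 * θ) : ℂ)).det := by
  have h1 : (1 : Matrix (Fin 6) (Fin 6) ℂ)
      = (Rd6 (-α)).map (Complex.ofRealHom) * (Rd6 α).map (Complex.ofRealHom) := by
    rw [← Matrix.map_mul, Rd6_mul]; simp
  have h2 : ((Rd6 α).map (Complex.ofRealHom)).det = 1 := by
    have := RingHom.map_det Complex.ofRealHom (Rd6 α)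
    rw [Rd6_det] at this
    simpa using this.symm
  have h3 : (N3 θ b₁ b₂ b₃ b₄ * Rd6 α).map (fun x : ℝ => (x : ℂ))
      = (N3 θ b₁ b₂ b₃ b₄).map (Complex.ofRealHom) * (Rd6 α).map (Complex.ofRealHom) := by
    rw [← Matrix.map_mul]; rfl
  rw [h3, h1, ← Matrix.smul_mul, ← Matrix.sub_mul, Matrix.det_mul, h2, mul_one, ← sparse_eq]
  rfl

lemma charpoly_eq (θ b₁ b₂ b₃ b₄ : ℝ) :
    ((N3 θ b₁ b₂ b₃ b₄).map (fun x : ℝ => (x : ℂ))).charpoly =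
        (X - C (Complex.exp (θ * Complex.I)))^3
          * (X - C ((starRingEnd ℂ) (Complex.exp (θ * Complex.I))))^3 := by
  have h : Matrix.charmatrix ((N3 θ b₁ b₂ b₃ b₄).map (fun x : ℝ => (x : ℂ)))
      = - sparseM (C (Real.cos θ : ℂ) - X) 0 (C (Real.sin θ : ℂ)) (C (b₁ : ℂ)) (C (b₂ : ℂ))
        (C (b₃ : ℂ)) (C (b₄ : ℂ)) (C (Real.sin (2 * θ) : ℂ)) (C (Real.cos (2 * θ) : ℂ)) := by
    ext1 i j
    fin_cases i <;> fin_cases j <;> simp [N3, sparseM]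
  rw [Matrix.charpoly, h, Matrix.det_neg, sparseM_det, exp_eq, ← mul_pow]
  have hI : (C Complex.I : ℂ[X]) ^ 2 = -1 := by
    rw [← C_pow, Complex.I_sq]; simp
  simp only [map_add, map_mul, Complex.conj_ofReal, Complex.conj_I, map_neg, Fintype.card_fin]
  have : (X - (C (Real.cos θ : ℂ) + C (Real.sin θ : ℂ) * C Complex.I))
     * (X - (C (Real.cos θ : ℂ) + C (Real.sin θ : ℂ) * - C Complex.I))
     = (C (Real.cos θ : ℂ) - X) ^ 2 + (C (Real.sin θ : ℂ)) ^ 2 := by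
    linear_combination (-(C (Real.sin θ : ℂ)) ^ 2) * hI
  rw [this]; ring

lemma finrank_eq (θ b₁ b₂ b₃ b₄ : ℝ) (hs : Real.sin θ ≠ 0) :
    Module.finrank ℂ
        (LinearMap.ker
          (((N3 θ b₁ b₂ b₃ b₄).map (fun x : ℝ => (x : ℂ))
            - Complex.exp (θ * Complex.I) • (1 : Matrix (Fin 6) (Fin 6) ℂ)).mulVecLin))
      = 1 := by
  have hI := Complex.I_sq
  have hsC : (Real.sin θ : ℂ) ≠ 0 := by exact_mod_cast hs
  have hA : (N3 θ b₁ b₂ b₃ b₄).map (fun x : ℝ => (x : ℂ))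
            - Complex.exp (θ * Complex.I) • (1 : Matrix (Fin 6) (Fin 6) ℂ)
      = sparseM (-((Real.sin θ : ℂ) * Complex.I)) 0 (Real.sin θ : ℂ)
        b₁ b₂ b₃ b₄ (Real.sin (2 * θ) : ℂ) (Real.cos (2 * θ) : ℂ) := by
    have h1 : (1 : Matrix (Fin 6) (Fin 6) ℂ) = (Rd6 (-0)).map (fun x : ℝ => (x : ℂ)) := by
      ext i j
      fin_cases i <;> fin_cases j <;> simp [Rd6]
    rw [h1, sparse_eq, exp_eq]
    congr 1 <;> simp
  rw [hA]
  have huv : (Real.sin (2 * θ) : ℂ) - Complex.I * (Real.cos (2 * θ) : ℂ) ≠ 0 := by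
    intro h
    have h1 := congrArg Complex.re h
    have h2 := congrArg Complex.im h
    simp only [Complex.sub_re, Complex.sub_im, Complex.mul_re, Complex.mul_im, Complex.I_re,
      Complex.I_im, Complex.ofReal_re, Complex.ofReal_im, Complex.zero_re, Complex.zero_im] at h1 h2
    have := Real.sin_sq_add_cos_sq (2 * θ)
    nlinarith
  generalize (Real.sin (2 * θ) : ℂ) = u at *
  generalize (Real.cos (2 * θ) : ℂ) = v at *
  generalize (Real.sin θ : ℂ) = s at *
  refine finrank_eq_one_iff'.mpr ⟨⟨![1, 0, -Complex.I, 0, 0, 0], ?_⟩, ?_, ?_⟩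
  · rw [LinearMap.mem_ker]
    ext i
    fin_cases i <;> simp [sparseM, Matrix.mulVec, dotProduct, Fin.sum_univ_succ]
    linear_combination s * hI
  · intro h
    have := congrFun (congrArg Subtype.val h) 0
    simp at this
  · rintro ⟨x, hx⟩
    rw [LinearMap.mem_ker] at hx
    have e0 : -(s * Complex.I) * x 0 + b₁ * x 1 - s * x 2 + b₂ * x 3 + x 4 = 0 := by
      have := congrFun hx 0
      simp [sparseM, Matrix.mulVec, dotProduct, Fin.sum_univ_six] at this
      linear_combination this
    have e1 : -(s * Complex.I) * x 1 - s * x 3 = 0 := by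
      have := congrFun hx 1
      simp [sparseM, Matrix.mulVec, dotProduct, Fin.sum_univ_six] at this
      linear_combination this
    have e2 : s * x 0 + b₃ * x 1 - s * Complex.I * x 2 + b₄ * x 3 + x 5 = 0 := by
      have := congrFun hx 2
      simp [sparseM, Matrix.mulVec, dotProduct, Fin.sum_univ_six] at this
      linear_combination this
    have e4 : u * x 1 + v * x 3 - s * Complex.I * x 4 - s * x 5 = 0 := by
      have := congrFun hx 4
      simp [sparseM, Matrix.mulVec, dotProduct, Fin.sum_univ_six] at this
      linear_combination this
    have e5 : -v * x 1 + u * x 3 + s * x 4 - s * Complex.I * x 5 = 0 := by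
      have := congrFun hx 5
      simp [sparseM, Matrix.mulVec, dotProduct, Fin.sum_univ_six] at this
      linear_combination this
    have h3 : x 3 = -Complex.I * x 1 := by
      apply mul_left_cancel₀ hsC
      linear_combination -e1
    have h1 : x 1 = 0 := by
      apply mul_left_cancel₀ huv
      rw [h3] at e4 e5
      linear_combination (1 / 2) * e4 + (Complex.I / 2) * e5
        + ((u * x 1 + s * x 5) / 2) * hI
    rw [h1, mul_zero] at h3
    rw [h1, h3] at e0 e2 e4
    have h5 : x 5 = -Complex.I * x 4 := by
      apply mul_left_cancel₀ hsC
      linear_combination -e4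
    rw [h5] at e2
    have h4 : x 4 = 0 := by
      linear_combination (1 / 2) * e0 + (Complex.I / 2) * e2 + ((s * x 2 + x 4) / 2) * hI
    rw [h4, mul_zero] at h5
    rw [h4] at e0
    have h2 : x 2 = -Complex.I * x 0 := by
      apply mul_left_cancel₀ hsC
      linear_combination -e0
    refine ⟨x 0, ?_⟩
    ext i
    fin_cases i <;> simp [h1, h2, h3, h4, h5, mul_comm]

/-- Derivative of the expanded determinant along a curve `(p, q)` along which p is stationary and q vanishes
at the base point. -/
lemma expansion_hasDerivAt {p q : ℝ → ℂ} {w s : ℂ} (hp : HasDerivAt p 0 0)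
    (hq : HasDerivAt q w 0) (hp0 : p 0 = -(s * Complex.I)) (hq0 : q 0 = 0)
    (b1 b2 b3 b4 u v : ℂ) :
    HasDerivAt (fun α : ℝ => (p α ^ 2 + s ^ 2) ^ 3
      + q α * (2 * s ^ 3 * v - 6 * p α * s ^ 2 * u - 6 * p α ^ 2 * s * v + 2 * p α ^ 3 * u
        + (p α ^ 2 + s ^ 2) * (2 * p α * s * (b2 - b3) + (s ^ 2 - p α ^ 2) * (b1 + b4)
          + 2 * s * (p α ^ 2 + s ^ 2)))
      + q α ^ 2 * remE (p α) (q α) s b1 b2 b3 b4 u v)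
      (w * (8 * s ^ 3 * (v + u * Complex.I))) 0 := by
  have hI := Complex.I_sq
  have dp := hp.differentiableAt
  have dq := hq.differentiableAt
  have hA := ((hp.pow 2).add_const (s ^ 2)).pow 3
  have hB : DifferentiableAt ℝ (fun α : ℝ => 2 * s ^ 3 * v - 6 * p α * s ^ 2 * u
      - 6 * p α ^ 2 * s * v + 2 * p α ^ 3 * u
        + (p α ^ 2 + s ^ 2) * (2 * p α * s * (b2 - b3) + (s ^ 2 - p α ^ 2) * (b1 + b4)
          + 2 * s * (p α ^ 2 + s ^ 2))) 0 := by fun_prop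
  have hE : DifferentiableAt ℝ (fun α : ℝ => remE (p α) (q α) s b1 b2 b3 b4 u v) 0 := by
    unfold remE
    fun_prop
  have hsum := (hA.add (hq.mul hB.hasDerivAt)).add ((hq.pow 2).mul hE.hasDerivAt)
  refine hsum.congr_deriv ?_
  have hp2 : p 0 ^ 2 + s ^ 2 = 0 := by
    rw [hp0]; linear_combination s ^ 2 * hI
  have hI3 : Complex.I ^ 3 = -Complex.I := by
    rw [pow_succ, hI]; ring
  simp only [Pi.pow_apply, hq0, hp2]
  rw [hp0]
  simp only [mul_pow, Even.neg_pow (by decide : Even 2), Odd.neg_pow (by decide : Odd 3),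
    hI, hI3]
  ring

lemma Dfun_hasDerivAt (θ b₁ b₂ b₃ b₄ : ℝ) :
    HasDerivAt (Dfun θ b₁ b₂ b₃ b₄) ((8 * Real.sin θ ^ 3 : ℝ) : ℂ) 0 := by
  have hI := Complex.I_sq
  have hw0 : Complex.exp (θ * Complex.I) ≠ 0 := Complex.exp_ne_zero _
  have hw2 : (Real.cos (2 * θ) : ℂ) + (Real.sin (2 * θ) : ℂ) * Complex.I
      = Complex.exp (θ * Complex.I) ^ 2 := by
    rw [← exp_eq, ← Complex.exp_nat_mul]
    congr 1
    push_cast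
    ring
  have hcw : (Real.cos θ : ℂ) - Complex.exp (θ * Complex.I)
      = -((Real.sin θ : ℂ) * Complex.I) := by
    rw [exp_eq]; ring
  have hF : Dfun θ b₁ b₂ b₃ b₄ = fun α : ℝ => _ :=
    funext fun α => by rw [Dfun, det_eq, sparseM_det]
  rw [hF]
  generalize Complex.exp (θ * Complex.I) = w at *
  generalize (Real.sin (2 * θ) : ℂ) = u at *
  generalize (Real.cos (2 * θ) : ℂ) = v at *
  rw [Complex.ofReal_mul, Complex.ofReal_pow]
  generalize (Real.sin θ : ℂ) = s at *
  generalize (Real.cos θ : ℂ) = c at *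
  have hp : HasDerivAt (fun α : ℝ => c - w * (Real.cos α : ℂ)) 0 0 := by
    have := ((Real.hasDerivAt_cos 0).ofReal_comp.const_mul w).const_sub c
    simpa using this
  have hq : HasDerivAt (fun α : ℝ => w * (Real.sin α : ℂ)) w 0 := by
    have := ((Real.hasDerivAt_sin 0).ofReal_comp.const_mul w)
    simpa using this
  have hp0 : c - w * (Real.cos 0 : ℂ) = -(s * Complex.I) := by
    rw [Real.cos_zero, ← hcw]; simp
  have hq0 : w * (Real.sin 0 : ℂ) = 0 := by simp
  have key := (expansion_hasDerivAt hp hq hp0 hq0 b₁ b₂ b₃ b₄ u v).const_mul (w⁻¹ ^ 3)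
  refine key.congr_deriv ?_
  rw [hw2]
  field_simp
  push_cast
  ring

/-- `ω = e^{iθ}` and `ω̄` are eigenvalues of `N₃(θ,b)` of algebraic multiplicity 3,
the `ω`-eigenspace is one-dimensional, `D_ω(M_α)` vanishes to first order exactly at
`α = 0` with `∂_α D_ω|₀ = 8 sin³θ`, hence `D_ω(M_α) ≠ 0` for `0 < |α| < α₀`. -/
theorem N3_eigen_properties (θ b₁ b₂ b₃ b₄ : ℝ)
    (hθ : θ ∈ Ioo (0:ℝ) (2 * Real.pi)) (hθπ : θ ≠ Real.pi)
    (hb : (b₂ - b₃) * Real.cos θ + (b₁ + b₄) * Real.sin θ = 1) :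
    (((N3 θ b₁ b₂ b₃ b₄).map (fun x : ℝ => (x : ℂ))).charpoly =
        (X - C (Complex.exp (θ * Complex.I)))^3
          * (X - C ((starRingEnd ℂ) (Complex.exp (θ * Complex.I))))^3) ∧
    (Module.finrank ℂ
        (LinearMap.ker
          (((N3 θ b₁ b₂ b₃ b₄).map (fun x : ℝ => (x : ℂ))
            - Complex.exp (θ * Complex.I) • (1 : Matrix (Fin 6) (Fin 6) ℂ)).mulVecLin))
      = 1) ∧
    Dfun θ b₁ b₂ b₃ b₄ 0 = 0 ∧
    deriv (Dfun θ b₁ b₂ b₃ b₄) 0 = ((8 * Real.sin θ ^ 3 : ℝ) : ℂ) ∧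
    ∃ α₀ > (0:ℝ), ∀ α : ℝ, α ≠ 0 → |α| < α₀ → Dfun θ b₁ b₂ b₃ b₄ α ≠ 0 := by
  
  have hs : Real.sin θ ≠ 0 := by
    obtain ⟨h0, h1⟩ := hθ
    rcases lt_or_gt_of_ne hθπ with h | h
    · exact (Real.sin_pos_of_pos_of_lt_pi h0 h).ne'
    · have := Real.sin_pos_of_pos_of_lt_pi (x := θ - Real.pi) (by linarith) (by linarith)
      rw [Real.sin_sub_pi] at this
      linarith
  have hD := Dfun_hasDerivAt θ b₁ b₂ b₃ b₄
  have h0 : Dfun θ b₁ b₂ b₃ b₄ 0 = 0 := by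
    rw [Dfun, det_eq, sparseM_det, exp_eq]
    have hI := Complex.I_sq
    have : ((Real.cos θ : ℂ) - ((Real.cos θ : ℂ) + (Real.sin θ : ℂ) * Complex.I)
        * (Real.cos 0 : ℂ)) ^ 2 + (Real.sin θ : ℂ) ^ 2 = 0 := by
      rw [Real.cos_zero, Complex.ofReal_one]
      linear_combination (Real.sin θ : ℂ) ^ 2 * hI
    rw [this, Real.sin_zero]; simp
  refine ⟨charpoly_eq θ b₁ b₂ b₃ b₄, finrank_eq θ b₁ b₂ b₃ b₄ hs, h0, hD.deriv, ?_⟩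
  have hne : ((8 * Real.sin θ ^ 3 : ℝ) : ℂ) ≠ 0 := by
    have : 8 * Real.sin θ ^ 3 ≠ 0 := by positivity
    exact_mod_cast this
  have hev := hD.eventually_ne (c := 0) hne
  rw [eventually_nhdsWithin_iff, Metric.eventually_nhds_iff] at hev
  obtain ⟨ε, hε, h⟩ := hev
  refine ⟨ε, hε, fun α hα hlt => h ?_ hα⟩
  simpa [Real.dist_eq] using hlt
end
end

section
/- In Sp(4), the set O_{R⁺,R⁺} of matrices whose four eigenvalues are distinct and lie in ℝ⁺\{1} (two pairs λ, 1/λ with λ > 1) is path-connected; similarly O_{R⁻,R⁻} (eigenvalues in ℝ⁻\{−1}) is path-connected. Specifically, any M ∈ O_{R⁺,R⁺} can be written as P⁻¹·diag(a, 1/a, b, 1/b)·P with a,b > 1 and P ∈ Sp(4), and any two such matrices can be joined by a continuous path within O_{R⁺,R⁺}. -/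
open Matrix Set Polynomial

noncomputable section

def J4 : Matrix (Fin 4) (Fin 4) ℝ :=
  !![0, -1, 0, 0; 1, 0, 0, 0; 0, 0, 0, -1; 0, 0, 1, 0]

/-- `O_{R⁺,R⁺}`: symplectic 4×4 matrices with four distinct eigenvalues
`{a, 1/a, b, 1/b}`, `a, b > 1`, `a ≠ b`. -/
def Opp : Set (Matrix (Fin 4) (Fin 4) ℝ) :=
  {M | Mᵀ * J4 * M = J4 ∧ ∃ a b : ℝ, 1 < a ∧ 1 < b ∧ a ≠ b ∧
    M.charpoly = (X - C a) * (X - C a⁻¹) * (X - C b) * (X - C b⁻¹)}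

/-- `O_{R⁻,R⁻}`: symplectic 4×4 matrices with four distinct eigenvalues
`{a, 1/a, b, 1/b}`, `a, b < −1`, `a ≠ b`. -/
def Omm : Set (Matrix (Fin 4) (Fin 4) ℝ) :=
  {M | Mᵀ * J4 * M = J4 ∧ ∃ a b : ℝ, a < -1 ∧ b < -1 ∧ a ≠ b ∧
    M.charpoly = (X - C a) * (X - C a⁻¹) * (X - C b) * (X - C b⁻¹)}

/-- The symplectic group for `J4`, as a set. -/
def SpSet : Set (Matrix (Fin 4) (Fin 4) ℝ) := {M | Mᵀ * J4 * M = J4}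

/-- The symplectic form. -/
def om (u v : Fin 4 → ℝ) : ℝ := u 1 * v 0 - u 0 * v 1 + u 3 * v 2 - u 2 * v 3

lemma mul_J_mul_apply (Q : Matrix (Fin 4) (Fin 4) ℝ) (i j : Fin 4) :
    (Qᵀ * J4 * Q) i j = om (Qᵀ i) (Qᵀ j) := by
  simp [Matrix.mul_apply, Fin.sum_univ_four, J4, om]
  ring

lemma mem_SpSet_iff (Q : Matrix (Fin 4) (Fin 4) ℝ) :
    Q ∈ SpSet ↔ ∀ i j, om (Qᵀ i) (Qᵀ j) = J4 i j := by
  constructor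
  · intro h i j
    rw [← mul_J_mul_apply, show Qᵀ * J4 * Q = J4 from h]
  · intro h
    ext i j
    rw [mul_J_mul_apply, h]

/-- `T c v * Q`, written columnwise: the transvection applied to the columns of `Q`. -/
def TQ (c : ℝ) (v : Fin 4 → ℝ) (Q : Matrix (Fin 4) (Fin 4) ℝ) : Matrix (Fin 4) (Fin 4) ℝ :=
  fun i j => Q i j + c * om v (Qᵀ j) * v i

lemma TQ_mem (c : ℝ) (v : Fin 4 → ℝ) {Q : Matrix (Fin 4) (Fin 4) ℝ} (hQ : Q ∈ SpSet) :
    TQ c v Q ∈ SpSet := by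
  rw [mem_SpSet_iff] at hQ ⊢
  intro i j
  rw [← hQ i j]
  simp only [om, TQ, Matrix.transpose_apply]
  ring

lemma TQ_joined (c : ℝ) (v : Fin 4 → ℝ) {Q : Matrix (Fin 4) (Fin 4) ℝ} (hQ : Q ∈ SpSet) :
    JoinedIn SpSet Q (TQ c v Q) := by
  refine JoinedIn.ofLine (f := fun t : ℝ => TQ (t * c) v Q) ?_ ?_ ?_ ?_
  · apply Continuous.continuousOn
    refine continuous_pi fun i => continuous_pi fun j => ?_
    simp only [TQ]
    fun_prop
  · ext i j
    simp [TQ]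
  · simp
  · rintro _ ⟨t, _, rfl⟩
    exact TQ_mem _ _ hQ

lemma move {Q : Matrix (Fin 4) (Fin 4) ℝ} (hQ : Q ∈ SpSet) (w : Fin 4 → ℝ) (k : Fin 4)
    (h : om w (Qᵀ k) ≠ 0) : ∃ Q', JoinedIn SpSet Q Q' ∧ Q'ᵀ k = w ∧
      ∀ j, om w (Qᵀ j) = J4 k j → Q'ᵀ j = Qᵀ j := by
  refine ⟨TQ (om w (Qᵀ k))⁻¹ (w - Qᵀ k) Q, TQ_joined _ _ hQ, ?_, ?_⟩
  · have e : om (w - Qᵀ k) (Qᵀ k) = om w (Qᵀ k) := by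
      simp only [om, Pi.sub_apply]; ring
    ext i
    simp only [TQ, Matrix.transpose_apply] at e ⊢
    rw [e, inv_mul_cancel₀ h]
    simp
  · intro j hj
    have e : om (w - Qᵀ k) (Qᵀ j) = 0 := by
      have h1 := (mem_SpSet_iff Q).1 hQ k j
      rw [← h1] at hj
      rw [← sub_eq_zero] at hj
      rw [← hj]
      simp only [om, Pi.sub_apply]; ring
    ext i
    simp only [TQ, Matrix.transpose_apply] at e ⊢
    rw [e]
    simp

lemma step1 {Q : Matrix (Fin 4) (Fin 4) ℝ} (hQ : Q ∈ SpSet) :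
    ∃ Q', JoinedIn SpSet Q Q' ∧ Q'ᵀ 0 = ![1, 0, 0, 0] := by
  have key : ∀ Q ∈ SpSet, Q 1 0 ≠ 0 → ∃ Q', JoinedIn SpSet Q Q' ∧ Q'ᵀ 0 = ![1, 0, 0, 0] := by
    intro Q hQ h
    obtain ⟨Q', h1, h2, -⟩ := move hQ ![1, 0, 0, 0] 0 (by simpa [om] using h)
    exact ⟨Q', h1, h2⟩
  have key2 : ∀ w : Fin 4 → ℝ, w 1 ≠ 0 → om w (Qᵀ 0) ≠ 0 →
      ∃ Q', JoinedIn SpSet Q Q' ∧ Q'ᵀ 0 = ![1, 0, 0, 0] := by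
    intro w hw h
    obtain ⟨Q', h1, h2, -⟩ := move hQ w 0 h
    obtain ⟨Q'', h3, h4⟩ := key Q' h1.target_mem (by
      have := congrFun h2 1
      rw [Matrix.transpose_apply] at this
      rwa [this])
    exact ⟨Q'', h1.trans h3, h4⟩
  by_cases h1 : Q 1 0 = 0
  swap
  · exact key Q hQ h1
  by_cases h0 : Q 0 0 = 0
  swap
  · exact key2 ![0, 1, 0, 0] (by simp) (by simpa [om] using h0)
  by_cases h2 : Q 2 0 = 0
  swap
  · exact key2 ![0, 1, 0, 1] (by simp) (by simpa [om, h0] using h2)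
  by_cases h3 : Q 3 0 = 0
  swap
  · exact key2 ![0, 1, 1, 0] (by simp) (by simpa [om, h0] using h3)
  have := (mem_SpSet_iff Q).1 hQ 0 1
  simp [om, J4, h0, h1, h2, h3] at this

lemma step2 {Q : Matrix (Fin 4) (Fin 4) ℝ} (hQ : Q ∈ SpSet) (h0 : Qᵀ 0 = ![1, 0, 0, 0]) :
    ∃ Q', JoinedIn SpSet Q Q' ∧ Q'ᵀ 0 = ![1, 0, 0, 0] ∧ Q'ᵀ 1 = ![0, 1, 0, 0] := by
  have h11 : Q 1 1 = 1 := by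
    have := (mem_SpSet_iff Q).1 hQ 0 1
    rw [h0] at this
    simpa [om, J4] using this
  have hj := TQ_joined (Q 0 1 - 1) ![1, 0, 0, 0] hQ
  set R := TQ (Q 0 1 - 1) ![1, 0, 0, 0] Q with hR
  have hR0 : Rᵀ 0 = ![1, 0, 0, 0] := by
    rw [← h0]
    ext i
    simp only [hR, TQ, Matrix.transpose_apply, h0]
    simp [om]
  have hR01 : R 0 1 = 1 := by
    simp [hR, TQ, om, h11]
  obtain ⟨Q', h1, h2, h3⟩ := move hj.target_mem ![0, 1, 0, 0] 1 (by simp [om, hR01])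
  refine ⟨Q', hj.trans h1, ?_, h2⟩
  rw [h3 0 ?_, hR0]
  rw [hR0]
  simp [om, J4]

lemma step3 {Q : Matrix (Fin 4) (Fin 4) ℝ} (hQ : Q ∈ SpSet) (h0 : Qᵀ 0 = ![1, 0, 0, 0])
    (h1 : Qᵀ 1 = ![0, 1, 0, 0]) :
    ∃ Q', JoinedIn SpSet Q Q' ∧ Q'ᵀ 0 = ![1, 0, 0, 0] ∧ Q'ᵀ 1 = ![0, 1, 0, 0] ∧
      Q'ᵀ 2 = ![0, 0, 1, 0] := by
  have key : ∀ Q ∈ SpSet, Qᵀ 0 = ![1, 0, 0, 0] → Qᵀ 1 = ![0, 1, 0, 0] → Q 3 2 ≠ 0 →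
      ∃ Q', JoinedIn SpSet Q Q' ∧ Q'ᵀ 0 = ![1, 0, 0, 0] ∧ Q'ᵀ 1 = ![0, 1, 0, 0] ∧
      Q'ᵀ 2 = ![0, 0, 1, 0] := by
    intro Q hQ h0 h1 h
    obtain ⟨Q', h2, h3, h4⟩ := move hQ ![0, 0, 1, 0] 2 (by simpa [om] using h)
    refine ⟨Q', h2, ?_, ?_, h3⟩
    · rw [h4 0 ?_, h0]
      rw [h0]; simp [om, J4]
    · rw [h4 1 ?_, h1]
      rw [h1]; simp [om, J4]
  by_cases h : Q 3 2 = 0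
  swap
  · exact key Q hQ h0 h1 h
  have h12 : Q 1 2 = 0 := by
    have := (mem_SpSet_iff Q).1 hQ 0 2
    rw [h0] at this
    simpa [om, J4] using this
  have h02 : Q 0 2 = 0 := by
    have := (mem_SpSet_iff Q).1 hQ 1 2
    rw [h1] at this
    simpa [om, J4] using this
  have h22 : Q 2 2 ≠ 0 := by
    intro h22
    have := (mem_SpSet_iff Q).1 hQ 2 3
    simp [om, J4, h, h12, h02, h22] at this
  have hj := TQ_joined 1 ![0, 0, 0, 1] hQ
  obtain ⟨Q', a, b⟩ := key _ hj.target_mem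
    (by rw [← h0]; ext i; simp only [TQ, Matrix.transpose_apply, h0]; simp [om])
    (by rw [← h1]; ext i; simp only [TQ, Matrix.transpose_apply, h1]; simp [om])
    (by simp [TQ, om, h, h22])
  exact ⟨Q', hj.trans a, b⟩

lemma step4 {Q : Matrix (Fin 4) (Fin 4) ℝ} (hQ : Q ∈ SpSet) (h0 : Qᵀ 0 = ![1, 0, 0, 0])
    (h1 : Qᵀ 1 = ![0, 1, 0, 0]) (h2 : Qᵀ 2 = ![0, 0, 1, 0]) : JoinedIn SpSet Q 1 := by
  have h13 : Q 1 3 = 0 := by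
    have := (mem_SpSet_iff Q).1 hQ 0 3
    rw [h0] at this
    simpa [om, J4] using this
  have h03 : Q 0 3 = 0 := by
    have := (mem_SpSet_iff Q).1 hQ 1 3
    rw [h1] at this
    simpa [om, J4] using this
  have h33 : Q 3 3 = 1 := by
    have := (mem_SpSet_iff Q).1 hQ 2 3
    rw [h2] at this
    simpa [om, J4] using this
  have hj := TQ_joined (Q 2 3) ![0, 0, 1, 0] hQ
  convert hj
  ext i j
  have e0 := fun i => congrFun h0 i
  have e1 := fun i => congrFun h1 i
  have e2 := fun i => congrFun h2 i
  simp only [Matrix.transpose_apply] at e0 e1 e2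
  fin_cases j <;> fin_cases i <;> simp [TQ, om, e0, e1, e2, h13, h03, h33]

lemma isPathConnected_SpSet : IsPathConnected SpSet := by
  refine ⟨1, by simp [SpSet], ?_⟩
  intro Q hQ
  obtain ⟨Q1, a1, b1⟩ := step1 hQ
  obtain ⟨Q2, a2, b2, c2⟩ := step2 a1.target_mem b1
  obtain ⟨Q3, a3, b3, c3, d3⟩ := step3 a2.target_mem b2 c2
  exact (a1.trans (a2.trans (a3.trans (step4 a3.target_mem b3 c3 d3)))).symm

lemma J4_mul_J4 : J4 * J4 = -1 := by
  ext i j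
  fin_cases i <;> fin_cases j <;> simp [J4, Matrix.mul_apply, Fin.sum_univ_four]

/-- The symplectic inverse. -/
def sinv (Q : Matrix (Fin 4) (Fin 4) ℝ) : Matrix (Fin 4) (Fin 4) ℝ := -(J4 * Qᵀ * J4)

lemma sinv_mul {Q : Matrix (Fin 4) (Fin 4) ℝ} (hQ : Q ∈ SpSet) : sinv Q * Q = 1 := by
  have h : Qᵀ * J4 * Q = J4 := hQ
  have : sinv Q * Q = -(J4 * (Qᵀ * J4 * Q)) := by
    simp only [sinv, Matrix.neg_mul, Matrix.mul_assoc]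
  rw [this, h, J4_mul_J4, neg_neg]

lemma mul_sinv {Q : Matrix (Fin 4) (Fin 4) ℝ} (hQ : Q ∈ SpSet) : Q * sinv Q = 1 :=
  mul_eq_one_comm.1 (sinv_mul hQ)

lemma symp_of_mul {Q R : Matrix (Fin 4) (Fin 4) ℝ} (hQ : Q ∈ SpSet) (hR : Q * R = 1) :
    R ∈ SpSet := by
  have h : Qᵀ * J4 * Q = J4 := hQ
  show Rᵀ * J4 * R = J4
  calc Rᵀ * J4 * R = Rᵀ * (Qᵀ * J4 * Q) * R := by rw [h]
    _ = (Q * R)ᵀ * J4 * (Q * R) := by simp only [Matrix.transpose_mul, Matrix.mul_assoc]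
    _ = J4 := by simp [hR]

lemma SpSet_mul {Q R : Matrix (Fin 4) (Fin 4) ℝ} (hQ : Q ∈ SpSet) (hR : R ∈ SpSet) :
    Q * R ∈ SpSet := by
  have h : Qᵀ * J4 * Q = J4 := hQ
  have h' : Rᵀ * J4 * R = J4 := hR
  show (Q * R)ᵀ * J4 * (Q * R) = J4
  calc (Q * R)ᵀ * J4 * (Q * R) = Rᵀ * (Qᵀ * J4 * Q) * R := by
        simp only [Matrix.transpose_mul, Matrix.mul_assoc]
    _ = J4 := by rw [h, h']

/-- The diagonal normal form. -/
def Dg (a b : ℝ) : Matrix (Fin 4) (Fin 4) ℝ := Matrix.diagonal ![a, a⁻¹, b, b⁻¹]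

lemma Dg_mem {a b : ℝ} (ha : a ≠ 0) (hb : b ≠ 0) : Dg a b ∈ SpSet := by
  rw [mem_SpSet_iff]
  intro i j
  fin_cases i <;> fin_cases j <;> simp [om, Dg, J4, Matrix.diagonal, ha, hb]

lemma exists_eigvec (M : Matrix (Fin 4) (Fin 4) ℝ) (μ : ℝ) (h : M.charpoly.eval μ = 0) :
    ∃ v : Fin 4 → ℝ, v ≠ 0 ∧ M *ᵥ v = μ • v := by
  rw [Matrix.eval_charpoly, ← Matrix.exists_mulVec_eq_zero_iff] at h
  obtain ⟨v, hv, h⟩ := h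
  refine ⟨v, hv, ?_⟩
  rw [Matrix.sub_mulVec, sub_eq_zero] at h
  rw [← h]
  simp

lemma om_mulVec {M : Matrix (Fin 4) (Fin 4) ℝ} (hM : M ∈ SpSet) (u v : Fin 4 → ℝ) :
    om (M *ᵥ u) (M *ᵥ v) = om u v := by
  have e : ∀ u v, om u v = u ⬝ᵥ (J4 *ᵥ v) := by
    intro u v
    simp [om, dotProduct, Matrix.mulVec, Fin.sum_univ_four, J4]
    ring
  have h : Mᵀ * J4 * M = J4 := hM
  rw [e, e]
  conv_rhs => rw [← h, ← Matrix.mulVec_mulVec, ← Matrix.mulVec_mulVec,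
    Matrix.dotProduct_mulVec, Matrix.vecMul_transpose]

lemma om_smul (x y : ℝ) (u v : Fin 4 → ℝ) : om (x • u) (y • v) = x * y * om u v := by
  simp [om]; ring

lemma om_antisymm (u v : Fin 4 → ℝ) : om u v = - om v u := by
  simp [om]; ring

lemma diagonalize {M : Matrix (Fin 4) (Fin 4) ℝ} (hM : M ∈ SpSet) {a b : ℝ}
    (ha : a ≠ 0) (hb : b ≠ 0) (haa : a * a ≠ 1) (hbb : b * b ≠ 1) (hab : a ≠ b) (hab' : a * b ≠ 1)
    (hc : M.charpoly = (X - C a) * (X - C a⁻¹) * (X - C b) * (X - C b⁻¹)) :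
    ∃ Q ∈ SpSet, M = Q * Dg a b * sinv Q := by
  let μ : Fin 4 → ℝ := ![a, a⁻¹, b, b⁻¹]
  have hex : ∀ i, ∃ v : Fin 4 → ℝ, v ≠ 0 ∧ M *ᵥ v = μ i • v := by
    intro i
    apply exists_eigvec
    rw [hc]
    fin_cases i <;> simp [μ]
  choose x hx0 hx using hex
  have hμ : Function.Injective μ := by
    have i1 : a ≠ a⁻¹ := fun h => haa (by nth_rw 2 [h]; exact mul_inv_cancel₀ ha)
    have i2 : b ≠ b⁻¹ := fun h => hbb (by nth_rw 2 [h]; exact mul_inv_cancel₀ hb)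
    have i3 : a ≠ b⁻¹ := fun h => hab' (by rw [h]; exact inv_mul_cancel₀ hb)
    have i4 : a⁻¹ ≠ b := fun h => hab' (by rw [← h]; exact mul_inv_cancel₀ ha)
    have i5 : a⁻¹ ≠ b⁻¹ := fun h => hab (inv_injective h)
    intro i j hij
    fin_cases i <;> fin_cases j <;> simp_all [μ, eq_comm]
  have hli : LinearIndependent ℝ x := by
    refine Module.End.eigenvectors_linearIndependent' (Matrix.toLin' M) μ hμ x fun i => ?_
    rw [Module.End.hasEigenvector_iff, Module.End.mem_eigenspace_iff]
    exact ⟨by simpa using hx i, hx0 i⟩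
  have hdet : (Matrix.of x).det ≠ 0 := by
    have : IsUnit (Matrix.of x) := Matrix.linearIndependent_rows_iff_isUnit.1 hli
    exact ((Matrix.isUnit_iff_isUnit_det _).1 this).ne_zero
  have horth : ∀ i j, μ i * μ j ≠ 1 → om (x i) (x j) = 0 := by
    intro i j h
    have h1 := om_mulVec hM (x i) (x j)
    rw [hx, hx, om_smul] at h1
    have h2 : (μ i * μ j - 1) * om (x i) (x j) = 0 := by linarith
    exact (mul_eq_zero.1 h2).resolve_left (sub_ne_zero.2 h)
  have hne : ∀ i j, i ≠ j → μ i ≠ μ j := fun i j h h' => h (hμ h')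
  have o02 : om (x 0) (x 2) = 0 := horth _ _ (by simpa [μ] using hab')
  have o03 : om (x 0) (x 3) = 0 := horth _ _ (by
    simpa [μ] using fun h => hab ((mul_inv_eq_one₀ hb).1 h))
  have o12 : om (x 1) (x 2) = 0 := horth _ _ (by
    simpa [μ] using fun h => hab ((inv_mul_eq_one₀ ha).1 h))
  have o13 : om (x 1) (x 3) = 0 := horth _ _ (by
    simp only [μ]
    intro h
    apply hab'
    simp at h
    rw [← mul_inv, inv_eq_one] at h
    exact h)
  have hnd : ∀ i, ∃ j, om (x i) (x j) ≠ 0 := by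
    intro i
    by_contra! hcon
    have hz : Matrix.of x *ᵥ ![x i 1, - x i 0, x i 3, - x i 2] = 0 := by
      ext j
      rw [Pi.zero_apply, ← hcon j]
      simp [Matrix.mulVec, dotProduct, Fin.sum_univ_four, om]
      ring
    have hz2 := Matrix.eq_zero_of_mulVec_eq_zero hdet hz
    apply hx0 i
    ext k
    have z0 := congrFun hz2 0
    have z1 := congrFun hz2 1
    have z2 := congrFun hz2 2
    have z3 := congrFun hz2 3
    simp at z0 z1 z2 z3
    fin_cases k <;> simp [z0, z1, z2, z3]
  have hself : ∀ u, om u u = 0 := by intro u; simp [om]; ring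
  have s0 : om (x 0) (x 1) ≠ 0 := by
    intro h
    obtain ⟨j, hj⟩ := hnd 0
    fin_cases j <;> simp_all
  have t0 : om (x 2) (x 3) ≠ 0 := by
    intro h
    obtain ⟨j, hj⟩ := hnd 2
    rw [om_antisymm] at o02 o12
    fin_cases j <;> simp_all
  let r : Fin 4 → ℝ := ![-(om (x 0) (x 1))⁻¹, 1, -(om (x 2) (x 3))⁻¹, 1]
  let Q : Matrix (Fin 4) (Fin 4) ℝ := (Matrix.of fun i => r i • x i)ᵀ
  have hQi : ∀ i, Qᵀ i = r i • x i := fun i => rfl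
  have hQ : Q ∈ SpSet := by
    rw [mem_SpSet_iff]
    have o20 := om_antisymm (x 2) (x 0)
    have o30 := om_antisymm (x 3) (x 0)
    have o21 := om_antisymm (x 2) (x 1)
    have o31 := om_antisymm (x 3) (x 1)
    have o10 := om_antisymm (x 1) (x 0)
    have o32 := om_antisymm (x 3) (x 2)
    intro i j
    rw [hQi, hQi, om_smul]
    fin_cases i <;> fin_cases j <;>
      simp [hself, o02, o03, o12, o13, o20, o30, o21, o31, o10, o32, r, J4, s0, t0]
  have hMQ : M * Q = Q * Dg a b := by
    ext i j
    have h1 : M *ᵥ (Qᵀ j) = μ j • Qᵀ j := by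
      rw [hQi, Matrix.mulVec_smul, hx, smul_comm]
    have h2 := congrFun h1 i
    rw [Dg, Matrix.mul_diagonal, mul_comm (Q i j)]
    exact h2
  refine ⟨Q, hQ, ?_⟩
  rw [← hMQ, Matrix.mul_assoc, mul_sinv hQ, Matrix.mul_one]

lemma conj_mem {Q : Matrix (Fin 4) (Fin 4) ℝ} (hQ : Q ∈ SpSet) {a b : ℝ}
    (ha : a ≠ 0) (hb : b ≠ 0) : (Q * Dg a b * sinv Q)ᵀ * J4 * (Q * Dg a b * sinv Q) = J4 ∧
    (Q * Dg a b * sinv Q).charpoly = (X - C a) * (X - C a⁻¹) * (X - C b) * (X - C b⁻¹) := by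
  refine ⟨SpSet_mul (SpSet_mul hQ (Dg_mem ha hb)) (symp_of_mul hQ (mul_sinv hQ)), ?_⟩
  rw [Matrix.charpoly_mul_comm, ← Matrix.mul_assoc, sinv_mul hQ, Matrix.one_mul, Dg,
    Matrix.charpoly_diagonal, Fin.prod_univ_four]
  simp

lemma pc_image {S : Set (ℝ × ℝ)} (hS : IsPathConnected S)
    (h0 : ∀ p ∈ S, p.1 ≠ 0 ∧ p.2 ≠ 0) :
    IsPathConnected (Set.image (fun q : Matrix (Fin 4) (Fin 4) ℝ × (ℝ × ℝ) =>
      q.1 * Dg q.2.1 q.2.2 * sinv q.1) (SpSet ×ˢ S)) := by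
  refine (isPathConnected_SpSet.prod hS).image' ?_
  have hD : ContinuousOn (fun q : Matrix (Fin 4) (Fin 4) ℝ × (ℝ × ℝ) => Dg q.2.1 q.2.2)
      (SpSet ×ˢ S) := by
    have h1 : ContinuousOn (fun q : Matrix (Fin 4) (Fin 4) ℝ × (ℝ × ℝ) => q.2.1⁻¹)
        (SpSet ×ˢ S) :=
      ContinuousOn.inv₀ (by fun_prop) (fun q hq => (h0 _ hq.2).1)
    have h2 : ContinuousOn (fun q : Matrix (Fin 4) (Fin 4) ℝ × (ℝ × ℝ) => q.2.2⁻¹)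
        (SpSet ×ˢ S) :=
      ContinuousOn.inv₀ (by fun_prop) (fun q hq => (h0 _ hq.2).2)
    refine continuousOn_pi.2 fun i => continuousOn_pi.2 fun j => ?_
    by_cases hij : i = j
    · subst hij
      simp only [Dg, Matrix.diagonal_apply_eq]
      fin_cases i
      · simpa using (by fun_prop)
      · simpa using h1
      · simpa using (by fun_prop)
      · simpa using h2
    · simp only [Dg, Matrix.diagonal_apply_ne _ hij]
      exact continuousOn_const
  have hs : Continuous (fun q : Matrix (Fin 4) (Fin 4) ℝ × (ℝ × ℝ) => sinv q.1) := by
    unfold sinv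
    fun_prop
  have hf : Continuous (fun q : Matrix (Fin 4) (Fin 4) ℝ × (ℝ × ℝ) => q.1) := continuous_fst
  rw [continuousOn_iff_continuous_restrict] at hD ⊢
  exact ((hf.comp continuous_subtype_val).matrix_mul hD).matrix_mul
    (hs.comp continuous_subtype_val)

lemma Opp_diag {M : Matrix (Fin 4) (Fin 4) ℝ} (hM : M ∈ Opp) :
    ∃ a b : ℝ, 1 < a ∧ a < b ∧ ∃ Q ∈ SpSet, M = Q * Dg a b * sinv Q := by
  have key : ∀ a b : ℝ, 1 < a → a < b →
      M.charpoly = (X - C a) * (X - C a⁻¹) * (X - C b) * (X - C b⁻¹) →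
      ∃ a b : ℝ, 1 < a ∧ a < b ∧ ∃ Q ∈ SpSet, M = Q * Dg a b * sinv Q := by
    intro a b h1 h2 hc
    refine ⟨a, b, h1, h2, diagonalize hM.1 ?_ ?_ ?_ ?_ h2.ne ?_ hc⟩
    · linarith
    · linarith
    all_goals apply ne_of_gt; nlinarith
  obtain ⟨-, a, b, ha, hb, hab, hc⟩ := id hM
  rcases hab.lt_or_gt with h | h
  · exact key a b ha h hc
  · exact key b a hb h (by rw [hc]; ring)

lemma Omm_diag {M : Matrix (Fin 4) (Fin 4) ℝ} (hM : M ∈ Omm) :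
    ∃ a b : ℝ, a < -1 ∧ b < a ∧ ∃ Q ∈ SpSet, M = Q * Dg a b * sinv Q := by
  have key : ∀ a b : ℝ, a < -1 → b < a →
      M.charpoly = (X - C a) * (X - C a⁻¹) * (X - C b) * (X - C b⁻¹) →
      ∃ a b : ℝ, a < -1 ∧ b < a ∧ ∃ Q ∈ SpSet, M = Q * Dg a b * sinv Q := by
    intro a b h1 h2 hc
    refine ⟨a, b, h1, h2, diagonalize hM.1 ?_ ?_ ?_ ?_ h2.ne' ?_ hc⟩
    · linarith
    · linarith
    all_goals apply ne_of_gt; nlinarith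
  obtain ⟨-, a, b, ha, hb, hab, hc⟩ := id hM
  rcases hab.lt_or_gt with h | h
  · exact key b a hb h (by rw [hc]; ring)
  · exact key a b ha h hc

lemma Opp_pc : IsPathConnected Opp := by
  have hS : IsPathConnected {p : ℝ × ℝ | 1 < p.1 ∧ p.1 < p.2} := by
    refine Convex.isPathConnected ?_ ⟨(2, 3), by norm_num⟩
    rintro ⟨a, b⟩ ⟨h1, h2⟩ ⟨c, d⟩ ⟨h3, h4⟩ s t hs ht hst
    simp only at h1 h2 h3 h4
    obtain rfl : s = 1 - t := by linarith
    simp only [Set.mem_setOf_eq, Prod.smul_mk, Prod.mk_add_mk, smul_eq_mul]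
    rcases ht.eq_or_lt with rfl | ht
    · constructor <;> linarith
    · constructor <;> nlinarith
  convert pc_image hS ?_ using 1
  · ext M
    constructor
    · intro hM
      obtain ⟨a, b, h1, h2, Q, hQ, h⟩ := Opp_diag hM
      exact ⟨(Q, (a, b)), ⟨hQ, h1, h2⟩, h.symm⟩
    · rintro ⟨⟨Q, ⟨a, b⟩⟩, ⟨hQ, h1, h2⟩, rfl⟩
      simp only at hQ h1 h2
      obtain ⟨c1, c2⟩ := conj_mem hQ (show a ≠ 0 by linarith) (show b ≠ 0 by linarith)
      exact ⟨c1, a, b, h1, h1.trans h2, h2.ne, c2⟩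
  · rintro ⟨a, b⟩ ⟨h1, h2⟩
    simp only at h1 h2 ⊢
    constructor <;> linarith

lemma Omm_pc : IsPathConnected Omm := by
  have hS : IsPathConnected {p : ℝ × ℝ | p.1 < -1 ∧ p.2 < p.1} := by
    refine Convex.isPathConnected ?_ ⟨(-2, -3), by norm_num⟩
    rintro ⟨a, b⟩ ⟨h1, h2⟩ ⟨c, d⟩ ⟨h3, h4⟩ s t hs ht hst
    simp only at h1 h2 h3 h4
    obtain rfl : s = 1 - t := by linarith
    simp only [Set.mem_setOf_eq, Prod.smul_mk, Prod.mk_add_mk, smul_eq_mul]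
    rcases ht.eq_or_lt with rfl | ht
    · constructor <;> linarith
    · constructor <;> nlinarith
  convert pc_image hS ?_ using 1
  · ext M
    constructor
    · intro hM
      obtain ⟨a, b, h1, h2, Q, hQ, h⟩ := Omm_diag hM
      exact ⟨(Q, (a, b)), ⟨hQ, h1, h2⟩, h.symm⟩
    · rintro ⟨⟨Q, ⟨a, b⟩⟩, ⟨hQ, h1, h2⟩, rfl⟩
      simp only at hQ h1 h2
      obtain ⟨c1, c2⟩ := conj_mem hQ (show a ≠ 0 by linarith) (show b ≠ 0 by linarith)
      exact ⟨c1, a, b, h1, h2.trans h1, h2.ne', c2⟩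
  · rintro ⟨a, b⟩ ⟨h1, h2⟩
    simp only at h1 h2 ⊢
    constructor <;> linarith

/-- `O_{R⁺,R⁺}` and `O_{R⁻,R⁻}` are path-connected, and every `M ∈ O_{R⁺,R⁺}` is
symplectically conjugate to `diag(a, 1/a, b, 1/b)` with `a, b > 1`. -/
theorem Opp_Omm_pathConnected :
    IsPathConnected Opp ∧ IsPathConnected Omm ∧
    ∀ M ∈ Opp, ∃ (P : Matrix (Fin 4) (Fin 4) ℝ) (a b : ℝ),
      1 < a ∧ 1 < b ∧ Pᵀ * J4 * P = J4 ∧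
      M = P⁻¹ * Matrix.diagonal ![a, a⁻¹, b, b⁻¹] * P := by
  refine ⟨Opp_pc, Omm_pc, fun M hM => ?_⟩
  obtain ⟨a, b, h1, h2, Q, hQ, h⟩ := Opp_diag hM
  refine ⟨sinv Q, a, b, h1, h1.trans h2, symp_of_mul hQ (mul_sinv hQ), ?_⟩
  rw [Matrix.inv_eq_left_inv (mul_sinv hQ)]
  exact h
end
end
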